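/- Let G be an edge-colored complete graph K_n with maximum monochromatic degree Δ^mon(G) < ⌊n/2⌋ and containing no monochromatic triangle. Then every vertex of G is contained in properly colored cycles of every length from 4 to n. -/

import Mathlib

/-- An edge-colored graph (with total symmetric coloring `col`) contains a
monochromatic triangle. -/
def HasMonoTriangle {V : Type*} (col : V → V → ℕ) : Prop :=
  ∃ x y z : V, x ≠ y ∧ y ≠ z ∧ x ≠ z ∧ col x y = col y z ∧ col x y = col x z

/-- `c : ZMod ℓ → V` is a properly colored cycle of length `ℓ` in the
edge-colored complete graph with coloring `col`. -/
def IsPCCycle {V : Type*} {ℓ : ℕ} (col : V → V → ℕ) (c : ZMod ℓ → V) : Prop :=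
  Function.Injective c ∧
    ∀ i : ZMod ℓ, col (c i) (c (i + 1)) ≠ col (c (i + 1)) (c (i + 2))

/-- There is a properly colored cycle of length `ℓ` through `v`. -/
def PCThrough {V : Type*} (col : V → V → ℕ) (ℓ : ℕ) (v : V) : Prop :=
  ∃ c : ZMod ℓ → V, IsPCCycle col c ∧ ∃ i, c i = v

/-- `S` is a degenerate set of the edge-colored complete graph `col`. -/
def DegenSet {V : Type*} (col : V → V → ℕ) (S : Set V) : Prop :=
  S.Nonempty ∧ ∃ f : V → ℕ,
    (∀ u ∈ S, ∀ v ∈ S, u ≠ v → col u v = f u ∨ col u v = f v) ∧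
    (∀ u ∈ S, ∀ v, v ∉ S → col u v = f u)

theorem ZMod.induction_add_one {ℓ : ℕ} [NeZero ℓ] {P : ZMod ℓ → Prop} (i : ZMod ℓ) (hi : P i)
    (hs : ∀ j, P j → P (j + 1)) (j : ZMod ℓ) : P j := by
  have key : ∀ k : ℕ, P (i + k) := by
    intro k
    induction k with
    | zero => simpa using hi
    | succ k ih => simpa [add_assoc] using hs _ ih
  simpa using key (j - i).val

theorem ZMod.natCast_inj_of_lt {ℓ s t : ℕ} (hs : s < ℓ) (ht : t < ℓ)
    (h : (s : ZMod ℓ) = t) : s = t := by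
  rw [ZMod.natCast_eq_natCast_iff', Nat.mod_eq_of_lt hs, Nat.mod_eq_of_lt ht] at h
  exact h

theorem ZMod.natCast_ne_zero_of_lt {ℓ s : ℕ} (hs : s < ℓ) (h0 : s ≠ 0) : (s : ZMod ℓ) ≠ 0 := by
  intro h
  exact h0 (ZMod.natCast_inj_of_lt hs (by omega) (by simpa using h))

theorem ZMod.exists_lt_eq_add {ℓ : ℕ} [NeZero ℓ] (i j : ZMod ℓ) : ∃ k < ℓ, j = i + (k : ℕ) :=
  ⟨(j - i).val, ZMod.val_lt _, by simp⟩

/-- A properly colored path together with a suitable extra vertex closes up to a properly colored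
cycle. -/
theorem exists_pcCycle_of_path {V : Type*} {col : V → V → ℕ} {N m : ℕ} (hN : N = m + 1)
    (hm : 2 ≤ m) (p : ℕ → V) (x : V) (hinj : ∀ i < m, ∀ j < m, p i = p j → i = j)
    (hx : ∀ i < m, p i ≠ x)
    (hp : ∀ k, k + 2 < m → col (p k) (p (k + 1)) ≠ col (p (k + 1)) (p (k + 2)))
    (hfirst : col x (p 0) ≠ col (p 0) (p 1))
    (hlast : col (p (m - 2)) (p (m - 1)) ≠ col (p (m - 1)) x)
    (hclose : col (p (m - 1)) x ≠ col x (p 0)) :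
    ∃ e : ZMod N → V, IsPCCycle col e ∧ e 0 = x ∧ ∀ k < m, e ((k + 1 : ℕ) : ZMod N) = p k := by
  subst hN
  let q : ℕ → V := fun k => if k = 0 then x else p (k - 1)
  have hq : ∀ k : ℕ, q ((k : ZMod (m + 1)).val) = q (k % (m + 1)) := by
    intro k; rw [ZMod.val_natCast]
  refine ⟨fun i => q i.val, ⟨?_, ?_⟩, by simp [q], ?_⟩
  · intro i j hij
    have hi := ZMod.val_lt i
    have hj := ZMod.val_lt j
    apply ZMod.val_injective
    simp only [q] at hij
    split_ifs at hij with h1 h2 h2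
    · omega
    · exact absurd hij.symm (hx _ (by omega))
    · exact absurd hij (hx _ (by omega))
    · have := hinj _ (by omega) _ (by omega) hij
      omega
  · intro i
    obtain ⟨k, hk, rfl⟩ : ∃ k : ℕ, k < m + 1 ∧ i = (k : ZMod (m + 1)) :=
      ⟨i.val, ZMod.val_lt _, by simp⟩
    have e1 : ((k : ZMod (m + 1)) + 1) = ((k + 1 : ℕ) : ZMod (m + 1)) := by push_cast; rfl
    have e2 : ((k : ZMod (m + 1)) + 2) = ((k + 2 : ℕ) : ZMod (m + 1)) := by push_cast; rfl
    simp only [e1, e2, hq]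
    rw [Nat.mod_eq_of_lt hk]
    rcases Nat.lt_or_ge (k + 2) (m + 1) with h | h
    · rw [Nat.mod_eq_of_lt h, Nat.mod_eq_of_lt (show k + 1 < m + 1 by omega)]
      rcases Nat.eq_zero_or_pos k with rfl | h0
      · simpa [q] using hfirst
      · obtain ⟨t, rfl⟩ : ∃ t, k = t + 1 := ⟨k - 1, by omega⟩
        simpa [q] using hp t (by omega)
    · obtain h | h : k = m - 1 ∨ k = m := by omega
      · obtain ⟨t, rfl⟩ : ∃ t, m = t + 2 := ⟨m - 2, by omega⟩
        obtain rfl : k = t + 1 := by omega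
        rw [Nat.mod_eq_of_lt (show t + 1 + 1 < t + 2 + 1 by omega),
          show t + 1 + 2 = t + 2 + 1 by omega, Nat.mod_self]
        simpa [q] using hlast
      · subst h
        rw [Nat.mod_self, show k + 2 = 1 + (k + 1) by omega, Nat.add_mod_right,
          Nat.mod_eq_of_lt (show 1 < k + 1 by omega)]
        simpa [q, show k ≠ 0 by omega] using hclose
  · intro k hk
    change q _ = p k
    rw [hq, Nat.mod_eq_of_lt (by omega)]
    simp [q]

theorem IsPCCycle.ne_prev {V : Type*} {col : V → V → ℕ} {ℓ : ℕ} {c : ZMod ℓ → V}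
    (hc : IsPCCycle col c) (i : ZMod ℓ) :
    col (c (i - 1)) (c i) ≠ col (c i) (c (i + 1)) := by
  have := hc.2 (i - 1)
  rwa [show i - 1 + 1 = i by ring, show i - 1 + 2 = i + 1 by ring] at this

theorem IsPCCycle.reflect {V : Type*} {col : V → V → ℕ} (hsym : ∀ u v, col u v = col v u) {ℓ : ℕ}
    {c : ZMod ℓ → V} (hc : IsPCCycle col c) : IsPCCycle col (fun i => c (-i)) := by
  refine ⟨fun i j h => neg_injective (hc.1 h), fun i => ?_⟩
  have := hc.2 (-(i + 2))
  rw [show -(i + 2) + 1 = -(i + 1) by ring, show -(i + 2) + 2 = -i by ring] at this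
  change col (c (-i)) (c (-(i + 1))) ≠ col (c (-(i + 1))) (c (-(i + 2)))
  rw [hsym (c (-i)), hsym (c (-(i + 1))) (c (-(i + 2)))]
  exact this.symm

/-- The triangles of a coloring without monochromatic triangles. -/
theorem not_mono {V : Type*} {col : V → V → ℕ} (hmono : ¬ HasMonoTriangle col) {x y z : V}
    (hxy : x ≠ y) (hyz : y ≠ z) (hxz : x ≠ z) (h : col x y = col y z) : col x y ≠ col x z :=
  fun h' => hmono ⟨x, y, z, hxy, hyz, hxz, h, h'⟩

theorem IsPCCycle.insert_one {V : Type*} {col : V → V → ℕ} {ℓ : ℕ} (hℓ : 3 ≤ ℓ)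
    {c : ZMod ℓ → V} (hc : IsPCCycle col c) {v : V} (hv : ∃ i, c i = v)
    (hno : ¬ PCThrough col (ℓ + 1) v) {x : V} (hx : ∀ i, c i ≠ x) (i : ZMod ℓ) :
    col (c i) x = col (c (i - 1)) (c i) ∨ col x (c (i + 1)) = col (c (i + 1)) (c (i + 2)) ∨
      col (c i) x = col x (c (i + 1)) := by
  have : NeZero ℓ := ⟨by omega⟩
  by_contra! hcon
  obtain ⟨h1, h2, h3⟩ := hcon
  apply hno
  have c1 : ((ℓ - 1 : ℕ) : ZMod ℓ) = -1 := by
    rw [Nat.cast_sub (by omega)]; simp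
  have c2 : ((ℓ - 2 : ℕ) : ZMod ℓ) = -2 := by
    rw [Nat.cast_sub (by omega)]; simp
  obtain ⟨e, he, -, hek⟩ := exists_pcCycle_of_path (col := col) (N := ℓ + 1) rfl (by omega)
    (fun k => c (i + 1 + (k : ℕ))) x
    (fun s hs t ht h => ZMod.natCast_inj_of_lt hs ht (add_left_cancel (hc.1 h)))
    (fun s _ => hx _)
    (fun k _ => by
      have := hc.2 (i + 1 + k)
      push_cast
      simpa only [add_assoc] using this)
    (by simpa [add_assoc, one_add_one_eq_two] using h2)
    (by
      simp only [c1, c2]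
      rw [show i + 1 + -2 = i - 1 by ring, show i + 1 + -1 = i by ring]
      exact h1.symm)
    (by
      simp only [c1]
      rw [show i + 1 + -1 = i by ring]
      simpa using h3)
  obtain ⟨j, rfl⟩ := hv
  obtain ⟨k, hk, rfl⟩ := ZMod.exists_lt_eq_add (i + 1) j
  exact ⟨e, he, _, hek k hk⟩

/-- A vertex that cannot be inserted in a properly colored cycle repeats along the cycle the colors
of the forward edges, or those of the backward edges, or sees the cycle in a single new color. -/
theorem IsPCCycle.trichotomy {V : Type*} {col : V → V → ℕ} (hsym : ∀ u v, col u v = col v u)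
    (hmono : ¬ HasMonoTriangle col) {ℓ : ℕ} (hℓ : 3 ≤ ℓ)
    {c : ZMod ℓ → V} (hc : IsPCCycle col c) {v : V} (hv : ∃ i, c i = v)
    (hno : ¬ PCThrough col (ℓ + 1) v) {x : V} (hx : ∀ i, c i ≠ x) :
    (∀ i, col x (c i) = col (c i) (c (i + 1))) ∨
    (∀ i, col x (c (i + 1)) = col (c i) (c (i + 1))) ∨
    (∃ a, ∀ i, col x (c i) = a ∧ col (c i) (c (i + 1)) ≠ a) := by
  have : NeZero ℓ := ⟨by omega⟩
  have hone : (1 : ZMod ℓ) ≠ 0 := by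
    simpa using ZMod.natCast_ne_zero_of_lt (show 1 < ℓ by omega) one_ne_zero
  have hadj : ∀ i, c i ≠ c (i + 1) := fun i h => hone (by simpa using hc.1 h)
  have hins := fun i => hc.insert_one hℓ hv hno hx i
  have hR : ∀ i, col x (c i) = col (c i) (c (i + 1)) →
      col x (c (i + 1)) = col (c (i + 1)) (c (i + 1 + 1)) := by
    intro i hi
    rw [show i + 1 + 1 = i + 2 by ring]
    rcases hins i with h | h | h
    · exact absurd (by rw [← h, hsym, hi]) (hc.ne_prev i)
    · exact h
    · exact absurd (by rw [hsym x, h]) (not_mono hmono (hx i).symm (hadj i) (hx _).symm hi)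
  have hL : ∀ i, col x (c (i + 1)) = col (c i) (c (i + 1)) →
      col x (c i) = col (c (i - 1)) (c i) := by
    intro i hi
    rcases hins i with h | h | h
    · rw [hsym, h]
    · exact absurd (by rw [← hi, h]) (hc.2 i)
    · refine absurd (by rw [hsym x, h]) (not_mono hmono (hx i).symm (hadj i) (hx _).symm ?_)
      rw [hsym, h, hi]
  by_cases h1 : ∃ i, col x (c i) = col (c i) (c (i + 1))
  · obtain ⟨i, hi⟩ := h1
    exact Or.inl (ZMod.induction_add_one i hi hR)
  by_cases h2 : ∀ i, col x (c (i + 1)) = col (c i) (c (i + 1))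
  · exact Or.inr (Or.inl h2)
  have h2' : ∀ i, col x (c (i + 1)) ≠ col (c i) (c (i + 1)) := by
    push Not at h1 h2
    obtain ⟨i, hi⟩ := h2
    refine ZMod.induction_add_one i hi fun j hj h => hj ?_
    simpa using hL (j + 1) h
  push Not at h1
  have hconst : ∀ i, col x (c i) = col x (c 0) := by
    refine ZMod.induction_add_one 0 rfl fun i hi => ?_
    rw [← hi]
    rcases hins i with h | h | h
    · have := h2' (i - 1)
      rw [sub_add_cancel, hsym] at this
      exact absurd h this
    · rw [show i + 2 = i + 1 + 1 by ring] at h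
      exact absurd h (h1 _)
    · rw [hsym x (c i), h]
  refine Or.inr (Or.inr ⟨col x (c 0), fun i => ⟨hconst i, fun h => h1 i ?_⟩⟩)
  rw [h, hconst]

/-- Two adjacent outer vertices can replace a vertex of a properly colored cycle. -/
theorem IsPCCycle.insert_two {V : Type*} {col : V → V → ℕ} {ℓ : ℕ} (hℓ : 3 ≤ ℓ)
    {c : ZMod ℓ → V} (hc : IsPCCycle col c) {v : V} (hv : ∃ i, c i = v) {x y : V} (hxy : x ≠ y)
    (hx : ∀ i, c i ≠ x) (hy : ∀ i, c i ≠ y) (i : ZMod ℓ) (hi : c (i + 1) ≠ v)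
    (h1 : col (c (i - 1)) (c i) ≠ col (c i) x) (h2 : col (c i) x ≠ col x y)
    (h3 : col x y ≠ col y (c (i + 2))) (h4 : col y (c (i + 2)) ≠ col (c (i + 2)) (c (i + 3))) :
    PCThrough col (ℓ + 1) v := by
  have : NeZero ℓ := ⟨by omega⟩
  have c1 : ((ℓ - 1 : ℕ) : ZMod ℓ) = -1 := by
    rw [Nat.cast_sub (by omega)]; simp
  have c2 : ((ℓ - 2 : ℕ) : ZMod ℓ) = -2 := by
    rw [Nat.cast_sub (by omega)]; simp
  obtain ⟨e, he, -, hek⟩ := exists_pcCycle_of_path (col := col) (N := ℓ + 1) rfl (by omega)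
    (fun k => if k = 0 then y else c (i + 1 + (k : ℕ))) x
    (fun s hs t ht h => by
      split_ifs at h with h1 h2 h2
      · omega
      · exact absurd h.symm (hy _)
      · exact absurd h (hy _)
      · exact ZMod.natCast_inj_of_lt hs ht (add_left_cancel (hc.1 h)))
    (fun s _ => by
      split_ifs
      · exact hxy.symm
      · exact hx _)
    (fun k _ => by
      rcases Nat.eq_zero_or_pos k with rfl | h0
      · simp only [if_true, zero_add, one_ne_zero, if_false, OfNat.ofNat_ne_zero]
        push_cast
        rw [show i + 1 + 1 = i + 2 by ring, show i + 1 + 2 = i + 3 by ring]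
        exact h4
      · have := hc.2 (i + 1 + k)
        simp only [h0.ne', if_false, Nat.add_eq_zero_iff, one_ne_zero, and_false,
          OfNat.ofNat_ne_zero]
        push_cast
        simpa only [add_assoc] using this)
    (by simpa [add_assoc, one_add_one_eq_two] using h3)
    (by
      simp only [c1, c2, show ℓ - 2 ≠ 0 by omega, show ℓ - 1 ≠ 0 by omega, if_false]
      rw [show i + 1 + -2 = i - 1 by ring, show i + 1 + -1 = i by ring]
      exact h1)
    (by
      simp only [c1, show ℓ - 1 ≠ 0 by omega, if_false, if_true]
      rw [show i + 1 + -1 = i by ring]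
      exact h2)
  obtain ⟨j, rfl⟩ := hv
  obtain ⟨k, hk, rfl⟩ := ZMod.exists_lt_eq_add (i + 1) j
  have hk0 : k ≠ 0 := by
    rintro rfl
    simp at hi
  exact ⟨e, he, _, (hek k hk).trans (by simp [hk0])⟩

/-- If `x` repeats the forward colors of a properly colored cycle, a chord whose color is not a
forward color of its ends yields a properly colored cycle through `x`. -/
theorem IsPCCycle.reroute {V : Type*} {col : V → V → ℕ} (hsym : ∀ u v, col u v = col v u)
    {ℓ : ℕ} {c : ZMod ℓ → V} (hc : IsPCCycle col c) {x : V} (hx : ∀ i, c i ≠ x)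
    (hR : ∀ i, col x (c i) = col (c i) (c (i + 1))) (a : ZMod ℓ) {s d N : ℕ} (hs : 1 ≤ s)
    (hsd : s + d + 2 ≤ ℓ) (hN : N = ℓ - d + 1)
    (h1 : col (c a) (c (a + (s + d : ℕ))) ≠ col (c a) (c (a + 1)))
    (h2 : col (c a) (c (a + (s + d : ℕ))) ≠
      col (c (a + (s + d : ℕ))) (c (a + (s + d : ℕ) + 1)))
    (h3 : col (c (a + (s : ℕ) - 1)) (c (a + (s : ℕ))) ≠ col (c (a - 1)) (c a)) :
    ∃ e : ZMod N → V, IsPCCycle col e ∧ e 0 = x ∧ ∀ k < ℓ - d,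
      e ((k + 1 : ℕ) : ZMod N) = c (a + ((if k < s then s - 1 - k else k + d : ℕ) : ℕ)) := by
  have hlast : a + ((ℓ - d - 1 + d : ℕ) : ZMod ℓ) = a - 1 := by
    rw [show ℓ - d - 1 + d = ℓ - 1 by omega, Nat.cast_sub (by omega)]; simp; ring
  have hlast' : a + ((ℓ - d - 2 + d : ℕ) : ZMod ℓ) = a - 2 := by
    rw [show ℓ - d - 2 + d = ℓ - 2 by omega, Nat.cast_sub (by omega)]; simp; ring
  have hs1 : a + ((s - 1 : ℕ) : ZMod ℓ) = a + (s : ℕ) - 1 := by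
    rw [Nat.cast_sub hs]; push_cast; ring
  apply exists_pcCycle_of_path hN (by omega)
    (fun k => c (a + ((if k < s then s - 1 - k else k + d : ℕ) : ℕ))) x
  · intro i hi j hj h
    have := ZMod.natCast_inj_of_lt (by split_ifs <;> omega) (by split_ifs <;> omega)
      (add_left_cancel (hc.1 h))
    split_ifs at this <;> omega
  · intro i _
    exact hx _
  · intro k hk
    rcases lt_trichotomy (k + 2) s with h | h | h
    · obtain ⟨t, rfl⟩ : ∃ t, s = t + k + 3 := ⟨s - k - 3, by omega⟩
      rw [if_pos (by omega), if_pos (by omega), if_pos (by omega),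
        show t + k + 3 - 1 - k = t + 2 by omega, show t + k + 3 - 1 - (k + 1) = t + 1 by omega,
        show t + k + 3 - 1 - (k + 2) = t by omega]
      have := hc.2 (a + t)
      rw [hsym (c (a + (t + 2 : ℕ))), hsym (c (a + (t + 1 : ℕ))) (c (a + (t : ℕ)))]
      push_cast
      simpa only [add_assoc] using this.symm
    · subst h
      rw [if_pos (by omega), if_pos (by omega), if_neg (by omega),
        show k + 2 - 1 - k = 1 by omega, show k + 2 - 1 - (k + 1) = 0 by omega, hsym]
      simpa using h1.symm
    · rcases Nat.lt_or_ge k s with h' | h'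
      · obtain rfl : s = k + 1 := by omega
        rw [if_pos (by omega), if_neg (by omega), if_neg (by omega),
          show k + 1 - 1 - k = 0 by omega, show k + 2 + d = k + 1 + d + 1 by ring,
          Nat.cast_zero, add_zero]
        rw [Nat.cast_succ (k + 1 + d), ← add_assoc]
        exact h2
      · rw [if_neg (by omega), if_neg (by omega), if_neg (by omega)]
        have := hc.2 (a + ((k + d : ℕ) : ZMod ℓ))
        rw [show k + 1 + d = k + d + 1 by ring, show k + 2 + d = k + d + 2 by ring,
          Nat.cast_add (k + d) 1, Nat.cast_add (k + d) 2]
        simpa only [add_assoc, Nat.cast_one, Nat.cast_ofNat] using this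
  · simp only [if_pos (show 0 < s by omega), Nat.sub_zero, hR, hs1]
    rcases Nat.lt_or_ge 1 s with h | h
    · rw [if_pos h, show a + (s : ZMod ℓ) - 1 + 1 = a + s by ring,
        show a + ((s - 1 - 1 : ℕ) : ZMod ℓ) = a + (s : ℕ) - 1 - 1 by
          rw [Nat.sub_sub, Nat.cast_sub (by omega)]; push_cast; ring, hsym _ (c (_ - 1 - 1))]
      have := (hc.ne_prev (a + (s : ZMod ℓ) - 1)).symm
      rwa [show a + (s : ZMod ℓ) - 1 + 1 = a + s by ring] at this
    · obtain rfl : s = 1 := by omega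
      simpa using h1.symm
  · simp only [if_neg (show ¬ ℓ - d - 2 < s by omega), if_neg (show ¬ ℓ - d - 1 < s by omega)]
    rw [hlast, hlast', hsym _ x, hR]
    have := hc.2 (a - 2)
    rwa [show a - 2 + 1 = a - 1 by ring, show a - 2 + 2 = a - 1 + 1 by ring] at this
  · simp only [if_neg (show ¬ ℓ - d - 1 < s by omega), if_pos (show 0 < s by omega), Nat.sub_zero]
    rw [hlast, hsym _ x, hR, hR, hs1]
    simpa using h3.symm

/-- The chord between `c a` and `c b` has neither of the forward colors of its ends. -/
def IsBadChord {V : Type*} {ℓ : ℕ} (col : V → V → ℕ) (c : ZMod ℓ → V) (a b : ZMod ℓ) : Prop :=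
  a ≠ b ∧ col (c a) (c b) ≠ col (c a) (c (a + 1)) ∧ col (c a) (c b) ≠ col (c b) (c (b + 1))

theorem IsBadChord.symm {V : Type*} {ℓ : ℕ} {col : V → V → ℕ} (hsym : ∀ u v, col u v = col v u)
    {c : ZMod ℓ → V} {a b : ZMod ℓ} (h : IsBadChord col c a b) : IsBadChord col c b a :=
  ⟨h.1.symm, by rw [hsym]; exact h.2.2, by rw [hsym]; exact h.2.1⟩

theorem IsBadChord.exists_gap {V : Type*} {ℓ : ℕ} {col : V → V → ℕ}
    (hsym : ∀ u v, col u v = col v u) (hℓ : 3 ≤ ℓ)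
    {c : ZMod ℓ → V} {a b : ZMod ℓ} (h : IsBadChord col c a b) :
    ∃ r : ℕ, 2 ≤ r ∧ r + 2 ≤ ℓ ∧ b = a + (r : ℕ) := by
  have : NeZero ℓ := ⟨by omega⟩
  obtain ⟨r, hr, rfl⟩ := ZMod.exists_lt_eq_add a b
  obtain ⟨h1, h2, h3⟩ := h
  have hr0 : r ≠ 0 := by
    rintro rfl
    simp at h1
  have hr1 : r ≠ 1 := by
    rintro rfl
    simp at h2
  have hr2 : r ≠ ℓ - 1 := by
    rintro rfl
    rw [Nat.cast_sub (by omega)] at h3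
    simp only [CharP.cast_eq_zero, Nat.cast_one, zero_sub, neg_add_cancel_right] at h3
    exact h3 (hsym _ _)
  exact ⟨r, by omega, by omega, rfl⟩

theorem IsBadChord.prev_eq {V : Type*} {col : V → V → ℕ} (hsym : ∀ u v, col u v = col v u)
    {ℓ : ℕ} (hℓ : 3 ≤ ℓ)
    {c : ZMod ℓ → V} (hc : IsPCCycle col c) {v : V} (hv : ∃ i, c i = v)
    (hno : ¬ PCThrough col (ℓ + 1) v) {x : V} (hx : ∀ i, c i ≠ x)
    (hR : ∀ i, col x (c i) = col (c i) (c (i + 1))) {a b : ZMod ℓ} (h : IsBadChord col c a b) :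
    col (c (a - 1)) (c a) = col (c (b - 1)) (c b) := by
  have : NeZero ℓ := ⟨by omega⟩
  obtain ⟨r, hr, hrℓ, rfl⟩ := h.exists_gap hsym hℓ
  by_contra hne
  obtain ⟨e, he, -, hek⟩ := hc.reroute hsym hx hR a (s := r) (d := 0) (by omega) (by omega) rfl
    h.2.1 h.2.2 (Ne.symm hne)
  apply hno
  obtain ⟨j, rfl⟩ := hv
  obtain ⟨k, hk, rfl⟩ := ZMod.exists_lt_eq_add a j
  refine ⟨e, he, _, (hek (if k < r then r - 1 - k else k) (by split_ifs <;> omega)).trans ?_⟩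
  congr 3
  split_ifs <;> omega

theorem IsBadChord.pred {V : Type*} {col : V → V → ℕ} (hsym : ∀ u v, col u v = col v u)
    (hmono : ¬ HasMonoTriangle col) {ℓ : ℕ} (hℓ : 3 ≤ ℓ)
    {c : ZMod ℓ → V} (hc : IsPCCycle col c) {v : V} (hv : ∃ i, c i = v)
    (hno : ¬ PCThrough col (ℓ + 1) v) {x : V} (hx : ∀ i, c i ≠ x)
    (hR : ∀ i, col x (c i) = col (c i) (c (i + 1))) {a b : ZMod ℓ} (h : IsBadChord col c a b) :
    IsBadChord col c (a - 1) (b - 1) := by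
  have hab : a - 1 ≠ b - 1 := fun h' => h.1 (sub_left_injective h')
  have hprev := h.prev_eq hsym hℓ hc hv hno hx hR
  have key : col (c (a - 1)) (c (b - 1)) ≠ col (c (a - 1)) (c a) := by
    intro h'
    have h1 := hR (a - 1)
    have h2 := hR (b - 1)
    rw [sub_add_cancel] at h1 h2
    exact not_mono hmono (hx _).symm (fun h => hab (hc.1 h)) (hx _).symm (h1.trans h'.symm)
      (by rw [h1, h2, hprev])
  refine ⟨hab, ?_, ?_⟩
  · simpa using key
  · simpa [← hprev] using key

theorem IsBadChord.add {V : Type*} {col : V → V → ℕ} (hsym : ∀ u v, col u v = col v u)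
    (hmono : ¬ HasMonoTriangle col) {ℓ : ℕ} (hℓ : 3 ≤ ℓ)
    {c : ZMod ℓ → V} (hc : IsPCCycle col c) {v : V} (hv : ∃ i, c i = v)
    (hno : ¬ PCThrough col (ℓ + 1) v) {x : V} (hx : ∀ i, c i ≠ x)
    (hR : ∀ i, col x (c i) = col (c i) (c (i + 1))) {a b : ZMod ℓ} (h : IsBadChord col c a b)
    (t : ZMod ℓ) : IsBadChord col c (a + t) (b + t) := by
  have : NeZero ℓ := ⟨by omega⟩
  have key := ZMod.induction_add_one (P := fun t => IsBadChord col c (a - t) (b - t)) 0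
    (by simpa using h) (fun j hj => by
      simpa [sub_sub] using hj.pred hsym hmono hℓ hc hv hno hx hR) (-t)
  simpa using key

theorem IsBadChord.forward_eq {V : Type*} {col : V → V → ℕ} (hsym : ∀ u v, col u v = col v u)
    (hmono : ¬ HasMonoTriangle col) {ℓ : ℕ} (hℓ : 3 ≤ ℓ)
    {c : ZMod ℓ → V} (hc : IsPCCycle col c) {v : V} (hv : ∃ i, c i = v)
    (hno : ¬ PCThrough col (ℓ + 1) v) {x : V} (hx : ∀ i, c i ≠ x)
    (hR : ∀ i, col x (c i) = col (c i) (c (i + 1))) {a b : ZMod ℓ} (h : IsBadChord col c a b) :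
    col (c a) (c (a + 1)) = col (c b) (c (b + 1)) := by
  simpa using (h.add hsym hmono hℓ hc hv hno hx hR 1).prev_eq hsym hℓ hc hv hno hx hR

theorem IsBadChord.color_of_ne {V : Type*} {col : V → V → ℕ} (hsym : ∀ u v, col u v = col v u)
    (hmono : ¬ HasMonoTriangle col) {ℓ : ℕ} (hℓ : 3 ≤ ℓ)
    {c : ZMod ℓ → V} (hc : IsPCCycle col c) {v : V} (hv : ∃ i, c i = v)
    (hno : ¬ PCThrough col (ℓ + 1) v) {x : V} (hx : ∀ i, c i ≠ x)
    (hR : ∀ i, col x (c i) = col (c i) (c (i + 1))) {a b : ZMod ℓ} (h : IsBadChord col c a b)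
    (hb : c (b - 1) ≠ v) :
    col (c a) (c b) = col (c (b - 1)) (c b) ∧
      col (c (b - 1)) (c (b + 1)) = col (c b) (c (b + 1)) := by
  have : NeZero ℓ := ⟨by omega⟩
  have hprev := h.prev_eq hsym hℓ hc hv hno hx hR
  obtain ⟨r, hr, hrℓ, rfl⟩ := h.exists_gap hsym hℓ
  obtain ⟨s, rfl⟩ : ∃ s, r = s + 1 := ⟨r - 1, by omega⟩
  have hbs : a + ((s + 1 : ℕ) : ZMod ℓ) - 1 = a + (s : ℕ) := by push_cast; ring
  have hbs' : a + ((s + 1 : ℕ) : ZMod ℓ) = a + (s : ℕ) + 1 := by push_cast; ring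
  rw [hbs] at hb hprev ⊢
  have hne : col (c (a + (s : ℕ) - 1)) (c (a + (s : ℕ))) ≠ col (c (a - 1)) (c a) := by
    rw [hprev, hbs']
    exact hc.ne_prev _
  obtain ⟨e, he, he0, hek⟩ := hc.reroute hsym hx hR a (s := s) (d := 1) (N := ℓ) (by omega)
    (by omega) (by omega) h.2.1 h.2.2 hne
  have hve : ∃ i, e i = v := by
    obtain ⟨j, rfl⟩ := hv
    obtain ⟨k, hk, rfl⟩ := ZMod.exists_lt_eq_add a j
    have hks : k ≠ s := by
      rintro rfl
      exact hb rfl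
    refine ⟨_, (hek (if k < s then s - 1 - k else k - 1) (by split_ifs <;> omega)).trans ?_⟩
    congr 3
    split_ifs <;> omega
  have hw : ∀ i, e i ≠ c (a + (s : ℕ)) := by
    intro i
    obtain ⟨k, hk, rfl⟩ := ZMod.exists_lt_eq_add 0 i
    rw [zero_add]
    rcases Nat.eq_zero_or_pos k with rfl | h0
    · rw [Nat.cast_zero, he0]
      exact (hx _).symm
    · obtain ⟨t, rfl⟩ : ∃ t, k = t + 1 := ⟨k - 1, by omega⟩
      rw [hek t (by omega)]
      intro h'
      have := ZMod.natCast_inj_of_lt (by split_ifs <;> omega) (by omega)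
        (add_left_cancel (hc.1 h'))
      split_ifs at this <;> omega
  have he1 : e 1 = c (a + (s : ℕ) - 1) := by
    have := hek 0 (by omega)
    rw [if_pos (by omega), Nat.sub_zero, Nat.cast_sub (by omega)] at this
    simpa [add_sub_assoc] using this
  have hF : col x (c (a + (s : ℕ) - 1)) = col (c (a + (s : ℕ) - 1)) (c (a + (s : ℕ))) := by
    rw [hR, sub_add_cancel]
  have hL : ∀ i, col (c (a + (s : ℕ))) (e (i + 1)) = col (e i) (e (i + 1)) := by
    rcases he.trichotomy hsym hmono hℓ hve hno hw with H | H | ⟨α, H⟩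
    · have h0 := H 0
      rw [zero_add, he0, he1, hF, hsym, hR] at h0
      exact absurd h0.symm (hc.ne_prev _)
    · exact H
    · have h0 := (H 0).2
      rw [zero_add, he0, ← (H 1).1, he1, hF, hsym] at h0
      exact absurd rfl h0
  have es : e ((s : ℕ) : ZMod ℓ) = c a := by
    obtain ⟨t, rfl⟩ : ∃ t, s = t + 1 := ⟨s - 1, by omega⟩
    rw [hek t (by omega), if_pos (by omega)]
    simp
  have es1 : e ((s : ℕ) + 1 : ZMod ℓ) = c (a + (s + 1 : ℕ)) := by
    have := hek s (by omega)
    rw [if_neg (by omega)] at this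
    simpa using this
  have es2 : e ((s : ℕ) + 1 + 1 : ZMod ℓ) = c (a + (s + 1 : ℕ) + 1) := by
    have := hek (s + 1) (by omega)
    rw [if_neg (by omega)] at this
    simpa [add_assoc, one_add_one_eq_two] using this
  have k1 := hL s
  have k2 := hL (s + 1)
  rw [es1, es] at k1
  rw [es1, es2] at k2
  exact ⟨k1.symm, k2⟩

theorem IsBadChord.four_eq_zero {V : Type*} {col : V → V → ℕ} (hsym : ∀ u v, col u v = col v u)
    (hmono : ¬ HasMonoTriangle col) {ℓ : ℕ} (hℓ : 3 ≤ ℓ)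
    {c : ZMod ℓ → V} (hc : IsPCCycle col c) {v : V} (hv : ∃ i, c i = v)
    (hno : ¬ PCThrough col (ℓ + 1) v) {x : V} (hx : ∀ i, c i ≠ x)
    (hR : ∀ i, col x (c i) = col (c i) (c (i + 1))) {a b : ZMod ℓ} (h : IsBadChord col c a b) :
    (4 : ZMod ℓ) = 0 ∧ col (c a) (c b) = col (c (a - 1)) (c a) := by
  have : NeZero ℓ := ⟨by omega⟩
  have hcol : ∀ a b, IsBadChord col c a b → col (c a) (c b) = col (c (a - 1)) (c a) := by
    intro a b h
    by_cases hb : c (b - 1) = v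
    · have ha : c (a - 1) ≠ v := fun ha => h.1 (sub_left_injective (hc.1 (ha.trans hb.symm)))
      rw [hsym]
      exact ((h.symm hsym).color_of_ne hsym hmono hℓ hc hv hno hx hR ha).1
    · rw [(h.color_of_ne hsym hmono hℓ hc hv hno hx hR hb).1,
        h.prev_eq hsym hℓ hc hv hno hx hR]
  have hdouble : ∀ a b, IsBadChord col c a b → (b - a) + (b - a) = 0 := by
    intro a b h
    by_contra hne
    have h' := h.add hsym hmono hℓ hc hv hno hx hR (b - a)
    rw [add_sub_cancel] at h'
    have hae : a ≠ b + (b - a) := by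
      intro h
      exact hne (by linear_combination -h)
    have f1 := h.forward_eq hsym hmono hℓ hc hv hno hx hR
    have f2 := h'.forward_eq hsym hmono hℓ hc hv hno hx hR
    have hne' : col (c a) (c (b + (b - a))) ≠ col (c a) (c (a + 1)) := by
      intro h''
      exact not_mono hmono (hx _).symm (fun h => hae (hc.1 h)) (hx _).symm
        ((hR a).trans h''.symm) (by rw [hR, hR, f1, f2])
    have h'' : IsBadChord col c a (b + (b - a)) := ⟨hae, hne', by rw [← f2, ← f1]; exact hne'⟩
    refine not_mono hmono (fun e => h.1 (hc.1 e)) (fun e => h'.1 (hc.1 e))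
      (fun e => hae (hc.1 e)) ?_ ?_
    · rw [hcol _ _ h, hcol _ _ h', h.prev_eq hsym hℓ hc hv hno hx hR]
    · rw [hcol _ _ h, hcol _ _ h'']
  have htwo : ∀ a b, IsBadChord col c a b → c (b - 1) ≠ v → (4 : ZMod ℓ) = 0 := by
    intro a b h hb
    have h2 := (h.color_of_ne hsym hmono hℓ hc hv hno hx hR hb).2
    have n0 : (2 : ZMod ℓ) ≠ 0 := by
      simpa using ZMod.natCast_ne_zero_of_lt (show 2 < ℓ by omega) two_ne_zero
    have hbad : IsBadChord col c (b - 1) (b + 1) := by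
      refine ⟨fun h => n0 ?_, ?_, ?_⟩
      · linear_combination -h
      · rw [h2, sub_add_cancel]
        exact (hc.ne_prev b).symm
      · rw [h2]
        have := hc.2 b
        rwa [show b + 2 = b + 1 + 1 by ring] at this
    linear_combination hdouble _ _ hbad
  refine ⟨?_, hcol _ _ h⟩
  by_cases hb : c (b - 1) = v
  · have ha : c (a - 1) ≠ v := fun ha => h.1 (sub_left_injective (hc.1 (ha.trans hb.symm)))
    exact htwo _ _ (h.symm hsym) ha
  · exact htwo _ _ h hb

theorem PCThrough.of_four {V : Type*} {col : V → V → ℕ} {a b c d : V} (hab : a ≠ b) (hac : a ≠ c)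
    (had : a ≠ d) (hbc : b ≠ c) (hbd : b ≠ d) (hcd : c ≠ d) (h1 : col a b ≠ col b c)
    (h2 : col b c ≠ col c d) (h3 : col c d ≠ col d a) (h4 : col d a ≠ col a b) :
    PCThrough col 4 a := by
  obtain ⟨e, he, he0, -⟩ := exists_pcCycle_of_path (col := col) (N := 4) (m := 3) rfl (by omega)
    (fun k => if k = 0 then b else if k = 1 then c else d) a
    (fun i hi j hj h => by
      interval_cases i <;> interval_cases j <;> simp_all)
    (fun i hi => by interval_cases i <;> simp [hab.symm, hac.symm, had.symm])
    (fun k hk => by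
      obtain rfl : k = 0 := by omega
      simpa using h2)
    (by simpa using h1) (by simpa using h3) (by simpa using h4)
  exact ⟨e, he, 0, he0⟩

theorem PCThrough.of_three {V : Type*} {col : V → V → ℕ} {a b c : V} (hab : a ≠ b) (hac : a ≠ c)
    (hbc : b ≠ c) (h1 : col a b ≠ col b c) (h2 : col b c ≠ col c a) (h3 : col c a ≠ col a b) :
    PCThrough col 3 a := by
  obtain ⟨e, he, he0, -⟩ := exists_pcCycle_of_path (col := col) (N := 3) (m := 2) rfl (by omega)
    (fun k => if k = 0 then b else c) a
    (fun i hi j hj h => by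
      interval_cases i <;> interval_cases j <;> simp_all)
    (fun i hi => by interval_cases i <;> simp [hab.symm, hac.symm])
    (fun k hk => by omega)
    (by simpa using h1) (by simpa using h2) (by simpa using h3)
  exact ⟨e, he, 0, he0⟩

theorem forward_reflect {V : Type*} {col : V → V → ℕ} (hsym : ∀ u v, col u v = col v u) {ℓ : ℕ}
    {c : ZMod ℓ → V} {x : V} (hL : ∀ i, col x (c (i + 1)) = col (c i) (c (i + 1))) (i : ZMod ℓ) :
    col x (c (-i)) = col (c (-i)) (c (-(i + 1))) := by
  have := hL (-(i + 1))
  rw [show -(i + 1) + 1 = -i by ring] at this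
  rw [this, hsym]

theorem backward_reflect {V : Type*} {col : V → V → ℕ} (hsym : ∀ u v, col u v = col v u) {ℓ : ℕ}
    {c : ZMod ℓ → V} {x : V} (hR : ∀ i, col x (c i) = col (c i) (c (i + 1))) (i : ZMod ℓ) :
    col x (c (-(i + 1))) = col (c (-i)) (c (-(i + 1))) := by
  have := hR (-(i + 1))
  rw [show -(i + 1) + 1 = -i by ring] at this
  rw [this, hsym]

theorem exists_reflect_eq {V : Type*} {ℓ : ℕ} {c : ZMod ℓ → V} {v : V} (hv : ∃ i, c i = v) :
    ∃ i, c (-i) = v := by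
  obtain ⟨i, hi⟩ := hv
  exact ⟨-i, by rwa [neg_neg]⟩

/-- Vertices repeating the forward colors and vertices seeing the cycle in one new color are joined
by edges of that color. -/
theorem color_forward_new {V : Type*} {col : V → V → ℕ} {ℓ : ℕ} (hℓ : 3 ≤ ℓ)
    (hsym : ∀ u v, col u v = col v u)
    {c : ZMod ℓ → V} (hc : IsPCCycle col c) {v : V} (hv : ∃ i, c i = v)
    (hno : ¬ PCThrough col (ℓ + 1) v) {x y : V} (hx : ∀ i, c i ≠ x) (hy : ∀ i, c i ≠ y)
    (hR : ∀ i, col x (c i) = col (c i) (c (i + 1))) {α : ℕ}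
    (hN : ∀ i, col y (c i) = α ∧ col (c i) (c (i + 1)) ≠ α) : col y x = α := by
  have n1 : (1 : ZMod ℓ) ≠ 0 := by
    simpa using ZMod.natCast_ne_zero_of_lt (show 1 < ℓ by omega) one_ne_zero
  have n2 : (2 : ZMod ℓ) ≠ 0 := by
    simpa using ZMod.natCast_ne_zero_of_lt (show 2 < ℓ by omega) two_ne_zero
  by_contra hne
  rw [hsym] at hne
  have hxy : x ≠ y := by
    rintro rfl
    exact (hN 0).2 (by rw [← hR, (hN 0).1])
  have key : ∀ i, c (i + 1) ≠ v → col x y = col (c i) (c (i + 1)) := by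
    intro i hi
    by_contra hcol
    refine hno (hc.insert_two hℓ hv hxy hx hy i hi ?_ ?_ ?_ ?_)
    · rw [hsym _ x, hR]
      exact hc.ne_prev i
    · rw [hsym _ x, hR]
      exact Ne.symm hcol
    · rwa [(hN _).1]
    · rw [(hN _).1]
      have := (hN (i + 2)).2
      rw [show i + 2 + 1 = i + 3 by ring] at this
      exact this.symm
  obtain ⟨j, rfl⟩ := hv
  refine hc.2 j ?_
  rw [← key j fun h => n1 (by simpa using hc.1 h)]
  have := key (j + 1) fun h => n2 (by linear_combination hc.1 h)
  rwa [show j + 1 + 1 = j + 2 by ring] at this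

theorem not_isBadChord_of_both {V : Type*} {col : V → V → ℕ} (hsym : ∀ u v, col u v = col v u)
    (hmono : ¬ HasMonoTriangle col) {ℓ : ℕ} (hℓ : 3 ≤ ℓ)
    {c : ZMod ℓ → V} (hc : IsPCCycle col c) {v : V} (hv : ∃ i, c i = v)
    (hno : ¬ PCThrough col (ℓ + 1) v) {x y : V} (hx : ∀ i, c i ≠ x) (hy : ∀ i, c i ≠ y)
    (hR : ∀ i, col x (c i) = col (c i) (c (i + 1)))
    (hL : ∀ i, col y (c (i + 1)) = col (c i) (c (i + 1))) (a b : ZMod ℓ) :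
    ¬ IsBadChord col c a b := by
  intro h
  have h1 := (h.four_eq_zero hsym hmono hℓ hc hv hno hx hR).2
  have h2 := h.prev_eq hsym hℓ hc hv hno hx hR
  have ya := hL (a - 1)
  have yb := hL (b - 1)
  rw [sub_add_cancel] at ya yb
  exact not_mono hmono (hy a).symm (fun e => h.1 (hc.1 e)) (hy b).symm (ya.trans h1.symm)
    (by rw [ya, yb, h2])

/-- Not both the forward and the backward colors are repeated by outer vertices. -/
theorem not_forward_and_backward {V : Type*} {col : V → V → ℕ} (hsym : ∀ u v, col u v = col v u)
    (hmono : ¬ HasMonoTriangle col) {ℓ : ℕ} (hℓ : 3 ≤ ℓ)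
    {c : ZMod ℓ → V} (hc : IsPCCycle col c) {v : V} (hv : ∃ i, c i = v)
    (hno : ¬ PCThrough col (ℓ + 1) v) {x y : V} (hx : ∀ i, c i ≠ x) (hy : ∀ i, c i ≠ y)
    (hR : ∀ i, col x (c i) = col (c i) (c (i + 1)))
    (hL : ∀ i, col y (c (i + 1)) = col (c i) (c (i + 1))) : False := by
  have : NeZero ℓ := ⟨by omega⟩
  have n1 : (1 : ZMod ℓ) ≠ 0 := by
    simpa using ZMod.natCast_ne_zero_of_lt (show 1 < ℓ by omega) one_ne_zero
  have n2 : (2 : ZMod ℓ) ≠ 0 := by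
    simpa using ZMod.natCast_ne_zero_of_lt (show 2 < ℓ by omega) two_ne_zero
  have hxy : x ≠ y := by
    rintro rfl
    have h1 := hL 0
    rw [hR] at h1
    exact hc.2 0 (by simpa [one_add_one_eq_two] using h1.symm)
  obtain rfl | hℓ4 : ℓ = 3 ∨ 4 ≤ ℓ := by omega
  · obtain ⟨j, rfl⟩ := hv
    have y1 := hL (j - 1)
    have y2 := hL (j - 1 - 1)
    have x1 := hR (j - 1)
    have p1 := hc.ne_prev (j - 1)
    rw [sub_add_cancel] at y1 y2 x1 p1
    apply hno
    apply PCThrough.of_four (hy j) (fun e => n1 (by linear_combination hc.1 e)) (hx j)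
      (hy _).symm hxy.symm (hx (j - 1))
    · rw [hsym _ y, y1, y2]
      exact p1.symm
    · rw [y2, hsym _ x, x1]
      exact p1
    · rw [hsym _ x, x1, hR]
      exact hc.ne_prev j
    · rw [hR, hsym _ y, y1]
      exact (hc.ne_prev j).symm
  · have n3 : (3 : ZMod ℓ) ≠ 0 := by
      simpa using ZMod.natCast_ne_zero_of_lt (show 3 < ℓ by omega) three_ne_zero
    have hf : ∀ a b, a ≠ b → col (c a) (c b) = col (c a) (c (a + 1)) ∨
        col (c a) (c b) = col (c b) (c (b + 1)) := by
      intro a b hab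
      have := not_isBadChord_of_both hsym hmono hℓ hc hv hno hx hy hR hL a b
      simp only [IsBadChord] at this
      tauto
    have hb : ∀ a b, a ≠ b → col (c a) (c b) = col (c (a - 1)) (c a) ∨
        col (c a) (c b) = col (c (b - 1)) (c b) := by
      intro a b hab
      have := not_isBadChord_of_both hsym hmono hℓ (hc.reflect hsym) (exists_reflect_eq hv) hno
        (fun i => hy (-i)) (fun i => hx (-i)) (forward_reflect hsym hL)
        (backward_reflect hsym hR) (-a) (-b)
      simp only [IsBadChord, neg_neg, neg_add, ne_eq, neg_inj, ← sub_eq_add_neg] at this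
      rw [hsym (c (a - 1)), hsym (c (b - 1))]
      tauto
    have h3 : col (c 0) (c 1) = col (c 3) (c 4) := by
      have e1 := hc.2 0
      have e2 := hc.2 1
      have e3 := hc.2 2
      have f1 := hf 1 3 (fun h => n2 (by linear_combination -h))
      have f2 := hb 1 3 (fun h => n2 (by linear_combination -h))
      norm_num at e1 e2 e3 f1 f2
      rcases f1 with f1 | f1 <;> rcases f2 with f2 | f2 <;> rw [f1] at f2
      · exact absurd f2.symm e1
      · exact absurd f2 e2
      · exact f2.symm
      · exact absurd f2.symm e3
    have h0 : (0 : ZMod ℓ) ≠ 3 := n3.symm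
    have hcol : col (c 0) (c 3) = col (c 0) (c 1) := by
      have := hf 0 3 h0
      norm_num at this
      rw [← h3] at this
      tauto
    have x0 := hR 0
    have x3 := hR 3
    norm_num at x0 x3
    exact not_mono hmono (hx 0).symm (fun e => h0 (hc.1 e)) (hx 3).symm (x0.trans hcol.symm)
      (by rw [x0, x3, h3])

theorem not_degenSet {n : ℕ} {col : Fin n → Fin n → ℕ} (hsym : ∀ u v, col u v = col v u)
    (hdeg : ∀ (a : ℕ) (v : Fin n),
      (Finset.univ.filter fun u => u ≠ v ∧ col v u = a).card < n / 2) (S : Set (Fin n)) :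
    ¬ DegenSet col S := by
  classical
  rintro ⟨hne, f, hin, hout⟩
  set T := S.toFinset with hT
  have memT : ∀ u, u ∈ T ↔ u ∈ S := fun u => Set.mem_toFinset
  have hTpos : 0 < T.card := by
    obtain ⟨u, hu⟩ := hne
    exact Finset.card_pos.2 ⟨u, (memT u).2 hu⟩
  have hTn : T.card + Tᶜ.card = n := by simp
  let A : Fin n → ℕ := fun u => (T.filter fun w => w ≠ u ∧ col u w = f u).card
  have hA : ∀ u ∈ T, Tᶜ.card + A u + 1 ≤ n / 2 := by
    intro u hu
    refine le_trans (Nat.succ_le_succ ?_) (hdeg (f u) u)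
    rw [← Finset.card_union_of_disjoint]
    · apply Finset.card_le_card
      intro w hw
      simp only [Finset.mem_union, Finset.mem_compl, Finset.mem_filter, Finset.mem_univ,
        true_and] at hw ⊢
      rcases hw with hw | hw
      · exact ⟨fun h => hw (h ▸ hu), hout u ((memT u).1 hu) w fun h => hw ((memT w).2 h)⟩
      · exact hw.2
    · exact Finset.disjoint_left.2 fun w hw hw' =>
        Finset.mem_compl.1 hw (Finset.mem_filter.1 hw').1
  have hsum : T.card * (T.card - 1) ≤ 2 * ∑ u ∈ T, A u := by
    have e1 : ∑ u ∈ T, A u = ∑ u ∈ T, ∑ w ∈ T, if w ≠ u ∧ col u w = f u then 1 else 0 := by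
      exact Finset.sum_congr rfl fun u _ => Finset.card_filter _ _
    have e2 : ∑ u ∈ T, A u = ∑ u ∈ T, ∑ w ∈ T, if w ≠ u ∧ col u w = f w then 1 else 0 := by
      rw [e1, Finset.sum_comm]
      refine Finset.sum_congr rfl fun u _ => Finset.sum_congr rfl fun w _ => ?_
      simp only [hsym w u, ne_comm (a := u)]
    have e3 : T.card * (T.card - 1) = ∑ u ∈ T, ∑ w ∈ T, if w ≠ u then 1 else 0 := by
      rw [← smul_eq_mul, ← Finset.sum_const]
      refine Finset.sum_congr rfl fun u hu => ?_
      rw [← Finset.card_filter, Finset.filter_ne', Finset.card_erase_of_mem hu]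
    rw [two_mul]
    nth_rewrite 1 [e1]
    rw [e2, e3, ← Finset.sum_add_distrib]
    refine Finset.sum_le_sum fun u hu => ?_
    rw [← Finset.sum_add_distrib]
    refine Finset.sum_le_sum fun w hw => ?_
    by_cases h : w = u
    · simp [h]
    · rcases hin u ((memT u).1 hu) w ((memT w).1 hw) (Ne.symm h) with h' | h' <;> simp [h, h']
  have hsum' : ∑ u ∈ T, (Tᶜ.card + A u + 1) ≤ ∑ u ∈ T, n / 2 := Finset.sum_le_sum hA
  rw [Finset.sum_add_distrib, Finset.sum_add_distrib] at hsum'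
  simp only [Finset.sum_const, smul_eq_mul, mul_one] at hsum'
  have key : T.card * (2 * Tᶜ.card + (T.card - 1) + 2) ≤ T.card * (2 * (n / 2)) := by
    nlinarith
  have := Nat.le_of_mul_le_mul_left key hTpos
  omega

theorem not_forward {n : ℕ} {col : Fin n → Fin n → ℕ} (hsym : ∀ u v, col u v = col v u)
    (hdeg : ∀ (a : ℕ) (v : Fin n),
      (Finset.univ.filter fun u => u ≠ v ∧ col v u = a).card < n / 2)
    (hmono : ¬ HasMonoTriangle col) {ℓ : ℕ} (hℓ : 3 ≤ ℓ)
    {c : ZMod ℓ → Fin n} (hc : IsPCCycle col c) {v : Fin n} (hv : ∃ i, c i = v)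
    (hno : ¬ PCThrough col (ℓ + 1) v)
    (hout : ∀ x, (∀ i, c i ≠ x) → (∀ i, col x (c i) = col (c i) (c (i + 1))) ∨
      (∀ i, col x (c (i + 1)) = col (c i) (c (i + 1))))
    {x : Fin n} (hx : ∀ i, c i ≠ x) : ¬ ∀ i, col x (c i) = col (c i) (c (i + 1)) := by
  intro hR
  have hall : ∀ y, (∀ i, c i ≠ y) → ∀ i, col y (c i) = col (c i) (c (i + 1)) := by
    intro y hy
    rcases hout y hy with h | h
    · exact h
    · exact (not_forward_and_backward hsym hmono hℓ hc hv hno hx hy hR h).elim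
  obtain ⟨a, b, hbad⟩ : ∃ a b, IsBadChord col c a b := by
    by_contra! hcon
    refine not_degenSet hsym hdeg (Set.range c) ⟨⟨c 0, 0, rfl⟩, col x, ?_, ?_⟩
    · rintro _ ⟨a, rfl⟩ _ ⟨b, rfl⟩ hab
      have := hcon a b
      simp only [IsBadChord] at this
      have hab' : a ≠ b := fun h => hab (by rw [h])
      rw [hR, hR]
      tauto
    · rintro _ ⟨a, rfl⟩ y hy
      rw [hsym, hall y (fun i h => hy ⟨i, h⟩), hR]
  have h4 := (hbad.four_eq_zero hsym hmono hℓ hc hv hno hx hR).1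
  obtain rfl : ℓ = 4 := by
    have : ℓ ∣ 4 := (ZMod.natCast_eq_zero_iff 4 ℓ).1 (by exact_mod_cast h4)
    have := Nat.le_of_dvd (by omega) this
    interval_cases ℓ <;> omega
  have hsub : Finset.univ \ {c 0, c 2, c 3} ⊆
      Finset.univ.filter fun u => u ≠ c 0 ∧ col (c 0) u = col (c 0) (c 1) := by
    intro u hu
    simp only [Finset.mem_sdiff, Finset.mem_univ, true_and, Finset.mem_insert,
      Finset.mem_singleton, not_or, Finset.mem_filter] at hu ⊢
    refine ⟨hu.1, ?_⟩
    by_cases h : ∃ i, c i = u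
    · obtain ⟨i, rfl⟩ := h
      have : i = 0 ∨ i = 1 ∨ i = 2 ∨ i = 3 := by
        clear hu
        revert i
        decide
      rcases this with rfl | rfl | rfl | rfl
      · exact absurd rfl hu.1
      · rfl
      · exact absurd rfl hu.2.1
      · exact absurd rfl hu.2.2
    · push Not at h
      rw [hsym, hall u h, zero_add]
  have hcard := (Finset.le_card_sdiff {c 0, c 2, c 3} Finset.univ).trans
    (Finset.card_le_card hsub)
  have h3 : ({c 0, c 2, c 3} : Finset (Fin n)).card ≤ 3 := Finset.card_le_three
  have hn : 5 ≤ n := by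
    have h5 : (insert x (Finset.univ.image c)).card = 5 := by
      rw [Finset.card_insert_of_notMem (by simpa using hx),
        Finset.card_image_of_injective _ hc.1, Finset.card_univ, ZMod.card]
    have := Finset.card_le_univ (insert x (Finset.univ.image c))
    simpa [h5] using this
  have := hdeg (col (c 0) (c 1)) (c 0)
  rw [Finset.card_univ, Fintype.card_fin] at hcard
  omega

theorem PCThrough.succ {n : ℕ} {col : Fin n → Fin n → ℕ} (hsym : ∀ u v, col u v = col v u)
    (hdeg : ∀ (a : ℕ) (v : Fin n),
      (Finset.univ.filter fun u => u ≠ v ∧ col v u = a).card < n / 2)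
    (hmono : ¬ HasMonoTriangle col) {ℓ : ℕ} (hℓ : 3 ≤ ℓ) (hℓn : ℓ < n) {v : Fin n}
    (h : PCThrough col ℓ v) : PCThrough col (ℓ + 1) v := by
  have : NeZero ℓ := ⟨by omega⟩
  by_contra hno
  obtain ⟨c, hc, hv⟩ := h
  have n1 : (1 : ZMod ℓ) ≠ 0 := by
    simpa using ZMod.natCast_ne_zero_of_lt (show 1 < ℓ by omega) one_ne_zero
  have htri := fun x (hx : ∀ i, c i ≠ x) => hc.trichotomy hsym hmono hℓ hv hno hx
  have hnew : ∀ y, (∀ i, c i ≠ y) →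
      ¬ ∃ a, ∀ i, col y (c i) = a ∧ col (c i) (c (i + 1)) ≠ a := by
    intro y hy hyN
    refine not_degenSet hsym hdeg
      {y | (∀ i, c i ≠ y) ∧ ∃ a, ∀ i, col y (c i) = a ∧ col (c i) (c (i + 1)) ≠ a}
      ⟨⟨y, hy, hyN⟩, fun y => col y (c 0), ?_, ?_⟩
    · rintro u ⟨hu, a, ha⟩ w ⟨hw, b, hb⟩ huw
      dsimp only
      rw [(ha 0).1, (hb 0).1]
      by_contra! hcon
      obtain ⟨j, hj⟩ := hv
      refine hno (hc.insert_two hℓ ⟨j, hj⟩ huw hu hw j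
        (fun h => n1 (by simpa using hc.1 (h.trans hj.symm))) ?_ ?_ ?_ ?_)
      · rw [hsym _ u, (ha j).1]
        simpa using (ha (j - 1)).2
      · rw [hsym _ u, (ha j).1]
        exact hcon.1.symm
      · rw [(hb _).1]
        exact hcon.2
      · rw [(hb _).1]
        have := (hb (j + 2)).2
        rw [show j + 2 + 1 = j + 3 by ring] at this
        exact this.symm
    · rintro u ⟨hu, a, ha⟩ w hw
      dsimp only
      rw [(ha 0).1]
      by_cases hwc : ∃ i, c i = w
      · obtain ⟨i, rfl⟩ := hwc
        exact (ha i).1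
      · push Not at hwc
        rcases htri w hwc with h | h | h
        · exact color_forward_new hℓ hsym hc hv hno hwc hu h ha
        · refine color_forward_new hℓ hsym (hc.reflect hsym) (exists_reflect_eq hv) hno
            (fun i => hwc (-i)) (fun i => hu (-i)) (forward_reflect hsym h)
            fun i => ⟨(ha _).1, ?_⟩
          have := (ha (-(i + 1))).2
          rw [show -(i + 1) + 1 = -i by ring] at this
          rwa [hsym]
        · exact absurd ⟨hwc, h⟩ hw
  have hout : ∀ x, (∀ i, c i ≠ x) → (∀ i, col x (c i) = col (c i) (c (i + 1))) ∨
      (∀ i, col x (c (i + 1)) = col (c i) (c (i + 1))) := by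
    intro x hx
    rcases htri x hx with h | h | h
    · exact Or.inl h
    · exact Or.inr h
    · exact absurd h (hnew x hx)
  obtain ⟨x, hx⟩ : ∃ x, ∀ i, c i ≠ x := by
    by_contra! hcon
    have := Fintype.card_le_of_surjective c hcon
    rw [ZMod.card, Fintype.card_fin] at this
    omega
  rcases hout x hx with h | h
  · exact not_forward hsym hdeg hmono hℓ hc hv hno hout hx h
  · refine not_forward hsym hdeg hmono hℓ (hc.reflect hsym) (exists_reflect_eq hv) hno ?_
      (fun i => hx (-i)) (forward_reflect hsym h)
    intro y hy
    have hy' : ∀ i, c i ≠ y := fun i => by simpa using hy (-i)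
    rcases hout y hy' with h | h
    · exact Or.inr (backward_reflect hsym h)
    · exact Or.inl (forward_reflect hsym h)

theorem pcThrough_four {n : ℕ} {col : Fin n → Fin n → ℕ} (hsym : ∀ u v, col u v = col v u)
    (hdeg : ∀ (a : ℕ) (v : Fin n),
      (Finset.univ.filter fun u => u ≠ v ∧ col v u = a).card < n / 2)
    (hmono : ¬ HasMonoTriangle col) (hn : 4 ≤ n) (v : Fin n) : PCThrough col 4 v := by
  by_contra hno
  have htri : ∀ u w, u ≠ v → w ≠ v → col v u ≠ col v w →
      col u w = col v u ∨ col u w = col v w := by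
    intro u w hu hw huw
    by_contra! hcon
    refine hno (PCThrough.succ hsym hdeg hmono le_rfl (by omega)
      (PCThrough.of_three hu.symm hw.symm (by rintro rfl; exact huw rfl) hcon.1.symm ?_ ?_))
    · rw [hsym w v]
      exact hcon.2
    · rw [hsym w v]
      exact huw.symm
  have hmate : ∀ u w z, u ≠ v → w ≠ v → z ≠ v → u ≠ w → col v u = col v w →
      col v z ≠ col v w → col w z = col v z := by
    intro u w z hu hw hz huw hcol hzw
    by_contra hne
    have hwz : col w z = col v w := (htri w z hw hz hzw.symm).resolve_right hne
    have hnm : col v u ≠ col u w := fun h => not_mono hmono hu.symm huw hw.symm h hcol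
    refine hno (PCThrough.of_four hu.symm hw.symm hz.symm huw
      (by rintro rfl; exact hzw hcol) (by rintro rfl; exact hzw rfl) hnm ?_ ?_ ?_)
    · rw [hwz, ← hcol]
      exact hnm.symm
    · rw [hsym z v]
      exact hne
    · rw [hsym z v, hcol]
      exact hzw
  refine not_degenSet hsym hdeg {z | z ≠ v ∧ ∀ u, u ≠ v → u ≠ z → col v u ≠ col v z}
    ⟨?_, col v, ?_, ?_⟩
  · by_contra hempty
    have hclass : ∀ z, z ≠ v → ∃ u, u ≠ v ∧ u ≠ z ∧ col v u = col v z := by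
      intro z hz
      by_contra! hcon
      exact hempty ⟨z, hz, hcon⟩
    have : Nontrivial (Fin n) := Fin.nontrivial_iff_two_le.2 (by omega)
    obtain ⟨z, hz⟩ := exists_ne v
    obtain ⟨w, hw, hwz⟩ : ∃ w, w ≠ v ∧ col v w ≠ col v z := by
      by_contra! hcon
      have hd := hdeg (col v z) v
      rw [Finset.filter_congr (q := fun u => u ≠ v)
        (fun u _ => ⟨fun h => h.1, fun h => ⟨h, hcon u h⟩⟩), Finset.filter_ne',
        Finset.card_erase_of_mem (Finset.mem_univ v), Finset.card_univ, Fintype.card_fin] at hd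
      omega
    obtain ⟨z', hz', hne, hcz⟩ := hclass z hz
    obtain ⟨w', hw', hne', hcw⟩ := hclass w hw
    have h1 := hmate z' z w hz' hz hw hne hcz hwz
    have h2 := hmate w' w z hw' hw hz hne' hcw hwz.symm
    exact hwz (by rw [← h1, ← h2, hsym])
  · rintro u ⟨hu, hu'⟩ w ⟨hw, -⟩ huw
    exact htri u w hu hw (hu' w hw huw.symm).symm
  · rintro z ⟨hz, hz'⟩ y hy
    by_cases hyv : y = v
    · rw [hyv, hsym]
    · simp only [Set.mem_ofPred_eq, not_and, not_forall, not_not] at hy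
      obtain ⟨u, hu, huy, hcol⟩ := hy hyv
      have hzy : y ≠ z := by
        rintro rfl
        exact hz' u hu huy hcol
      rw [hsym]
      exact hmate u y z hu hyv hz huy hcol (hz' y hyv hzy).symm

/-- If an edge-colored $K_n$ has maximum monochromatic degree less than
$⌊n/2⌋$ and no monochromatic triangle, then every vertex lies on PC cycles of
all lengths from 4 to $n$. -/
theorem vertex_pancyclic_of_small_mono_degree
    (n : ℕ) (col : Fin n → Fin n → ℕ)
    (hsym : ∀ u v, col u v = col v u)
    (hdeg : ∀ (a : ℕ) (v : Fin n),
      (Finset.univ.filter fun u => u ≠ v ∧ col v u = a).card < n / 2)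
    (hmono : ¬ HasMonoTriangle col) :
    ∀ v : Fin n, ∀ ℓ : ℕ, 4 ≤ ℓ → ℓ ≤ n → PCThrough col ℓ v := by
  intro v ℓ h4 hℓ
  induction ℓ, h4 using Nat.le_induction with
  | base => exact pcThrough_four hsym hdeg hmono hℓ v
  | succ k hk ih => exact (ih (by omega)).succ hsym hdeg hmono (by omega) (by omega)
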